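/- Let P and Q be posets on the disjoint ground sets {1,...,n1} and {n1+1,...,n1+n2} respectively, let n = n1 + n2, and let P + Q be their parallel composition. Then QLB(P + Q) = QLB(P) + QLB(Q) + n·H_n − n1·H_{n1} − n2·H_{n2}. -/

import Mathlib

open MeasureTheory Finset

attribute [local instance] Classical.propDecidable

noncomputable def harm (q : ℕ) : ℝ := ∑ m ∈ Finset.range q, (1 : ℝ) / (m + 1)

noncomputable def linExts (α : Type) [Fintype α] (r : α → α → Prop) :
    Finset (α ≃ Fin (Fintype.card α)) :=
  Finset.univ.filter fun σ => ∀ i j : α, r i j → σ i ≤ σ j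

noncomputable def dN {α : Type} [Fintype α] (r : α → α → Prop)
    (σ : α ≃ Fin (Fintype.card α)) (i : α) : ℕ :=
  if ∀ j : α, r j i → j = i then (σ i : ℕ) + 1
  else sInf {m : ℕ | ∃ j : α, j ≠ i ∧ r j i ∧ m = (σ i : ℕ) - (σ j : ℕ)}

noncomputable def QLB (α : Type) [Fintype α] (r : α → α → Prop) : ℝ :=
  (∑ σ ∈ linExts α r, ∑ i : α, harm (dN r σ i - 1)) / ((linExts α r).card : ℝ)

def chainPolytope (α : Type) [Fintype α] (r : α → α → Prop) : Set (α → ℝ) :=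
  {y | (∀ i, 0 ≤ y i) ∧
    ∀ C : Finset α, (∀ i ∈ C, ∀ j ∈ C, r i j ∨ r j i) → ∑ i ∈ C, y i ≤ 1}

def orderPolytope (α : Type) [Fintype α] (r : α → α → Prop) : Set (α → ℝ) :=
  {y | (∀ i, 0 ≤ y i ∧ y i ≤ 1) ∧ ∀ i j : α, r i j → y i ≤ y j}

noncomputable def transferMap (α : Type) [Fintype α] (r : α → α → Prop)
    (y : α → ℝ) (i : α) : ℝ :=
  if ∀ j : α, r j i → j = i then y i
  else sInf {t : ℝ | ∃ j : α, j ≠ i ∧ r j i ∧ t = y i - y j}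

noncomputable def QH (α : Type) [Fintype α] (r : α → α → Prop) : ℝ :=
  ⨍ z in chainPolytope α r, -(1 / (Fintype.card α : ℝ)) * ∑ i : α, Real.log (z i)

noncomputable def posetEntropy (α : Type) [Fintype α] (r : α → α → Prop) : ℝ :=
  sInf {x : ℝ | ∃ z ∈ chainPolytope α r, (∀ i, 0 < z i) ∧
    x = -(1 / (Fintype.card α : ℝ)) * ∑ i : α, Real.log (z i)}

def seriesComp {α β : Type} (r : α → α → Prop) (s : β → β → Prop) :
    α ⊕ β → α ⊕ β → Prop
  | Sum.inl x, Sum.inl y => r x y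
  | Sum.inr x, Sum.inr y => s x y
  | Sum.inl _, Sum.inr _ => True
  | Sum.inr _, Sum.inl _ => False

def parallelComp {α β : Type} (r : α → α → Prop) (s : β → β → Prop) :
    α ⊕ β → α ⊕ β → Prop
  | Sum.inl x, Sum.inl y => r x y
  | Sum.inr x, Sum.inr y => s x y
  | _, _ => False

theorem harm_succ (q : ℕ) : harm (q + 1) = harm q + 1 / ((q : ℝ) + 1) := by
  simp [harm, Finset.sum_range_succ]

/-- Every linear order extending `r` gives a linear extension, so there is at least one. -/
theorem linExts_nonempty (α : Type) [Fintype α] (r : α → α → Prop) [IsPartialOrder α r] :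
    (linExts α r).Nonempty := by
  obtain ⟨t, ht, hrt⟩ := extend_partialOrder r
  let _ : LinearOrder α :=
    { le := t
      le_refl := refl_of t
      le_trans := fun _ _ _ => trans_of t
      le_antisymm := fun _ _ => antisymm_of t
      le_total := total_of t
      toDecidableLE := Classical.decRel _ }
  let o : Fin (Fintype.card α) ≃o α := Fintype.orderIsoFinOfCardEq α rfl
  refine ⟨o.symm.toEquiv, ?_⟩
  simp only [linExts, Finset.mem_filter, Finset.mem_univ, true_and]
  intro i j hij
  exact o.symm.monotone (hrt i j hij)

section OrderEmbeddings

noncomputable instance orderEmbFintype (m n : ℕ) : Fintype (Fin m ↪o Fin n) :=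
  Fintype.ofFinite _

/-- Double counting of the pairs of an order embedding and a point outside its range. -/
theorem sum_orderEmb_succ {m n : ℕ} (hmn : m ≤ n) (F : (Fin m ↪o Fin (n + 1)) → ℝ) :
    ((n : ℝ) + 1 - m) * ∑ e, F e =
      ∑ e : Fin m ↪o Fin n, ∑ k : Fin (n + 1), F (e.trans (Fin.succAboveOrderEmb k)) := by
  have hfiber (k : Fin (n + 1)) : ∑ e : Fin m ↪o Fin n, F (e.trans (Fin.succAboveOrderEmb k)) =
      ∑ e with ∀ i, e i ≠ k, F e := by
    refine Finset.sum_bij (fun e _ => e.trans (Fin.succAboveOrderEmb k)) ?_ ?_ ?_ ?_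
    · intro e _
      simp [Fin.succAbove_ne]
    · intro e _ e' _ h
      ext i : 1
      have := DFunLike.congr_fun h i
      simpa using this
    · intro e he
      simp only [Finset.mem_filter, Finset.mem_univ, true_and] at he
      choose g hg using fun i => Fin.exists_succAbove_eq (he i)
      refine ⟨OrderEmbedding.ofStrictMono g fun i j hij => ?_, Finset.mem_univ _, ?_⟩
      · rw [← Fin.succAbove_lt_succAbove_iff (p := k), hg, hg]
        exact e.strictMono hij
      · ext i : 1
        exact hg i
    · simp
  rw [Finset.sum_comm, Finset.sum_congr rfl fun k _ => hfiber k]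
  simp_rw [Finset.sum_filter]
  rw [Finset.sum_comm, Finset.mul_sum]
  refine Finset.sum_congr rfl fun e _ => ?_
  rw [← Finset.sum_filter, Finset.sum_const, nsmul_eq_mul]
  congr 1
  have hset : ({k | ∀ i, e i ≠ k} : Finset (Fin (n + 1))) = (Finset.univ.map e.toEmbedding)ᶜ := by
    ext k
    simp
  rw [hset, Finset.card_compl, Finset.card_map, Finset.card_univ, Fintype.card_fin,
    Fintype.card_fin, Nat.cast_sub (by omega)]
  push_cast
  ring

theorem card_orderEmb_succ {m n : ℕ} (hmn : m ≤ n) :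
    ((n : ℝ) + 1 - m) * Fintype.card (Fin m ↪o Fin (n + 1)) =
      Fintype.card (Fin m ↪o Fin n) * ((n : ℝ) + 1) := by
  simpa [mul_add] using sum_orderEmb_succ hmn (fun _ => 1)

theorem sum_harm_add_ite {n lo c : ℕ} (h : lo + c < n) :
    ∑ k : Fin (n + 1), harm (c + if lo ≤ (k : ℕ) ∧ (k : ℕ) ≤ lo + c then 1 else 0) =
      ((n : ℝ) + 1) * harm c + 1 := by
  have hterm (k : Fin (n + 1)) :
      harm (c + if lo ≤ (k : ℕ) ∧ (k : ℕ) ≤ lo + c then 1 else 0) =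
        harm c + if lo ≤ (k : ℕ) ∧ (k : ℕ) ≤ lo + c then 1 / ((c : ℝ) + 1) else 0 := by
    split_ifs <;> simp [harm_succ]
  have hcard : (({k | lo ≤ (k : ℕ) ∧ (k : ℕ) ≤ lo + c} : Finset (Fin (n + 1))).card) = c + 1 := by
    have : ({k | lo ≤ (k : ℕ) ∧ (k : ℕ) ≤ lo + c} : Finset (Fin (n + 1))) =
        Finset.Icc ⟨lo, by omega⟩ ⟨lo + c, by omega⟩ := by
      ext k
      simp [Fin.le_def]
    rw [this, Fin.card_Icc]
    simp only
    omega
  simp_rw [hterm]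
  rw [Finset.sum_add_distrib, ← Finset.sum_filter, Finset.sum_const, Finset.sum_const, hcard]
  simp
  field_simp

/-- The number of points strictly between the images of `a` and `b`; for `a = none`, the number of
points strictly before the image of `b`. -/
def gap {m n : ℕ} (a : Option (Fin m)) (b : Fin m) (e : Fin m ↪o Fin n) : ℕ :=
  a.elim (e b : ℕ) fun a => (e b : ℕ) - e a - 1

/-- Inserting a point at `k` increases a gap by one exactly when `k` is one of its slots. -/
theorem gap_trans_succAbove {m n : ℕ} (a : Option (Fin m)) (b : Fin m) (hab : ∀ x ∈ a, x < b)
    (e : Fin m ↪o Fin n) :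
    ∃ lo, lo + gap a b e < n ∧ ∀ k : Fin (n + 1),
      gap a b (e.trans (Fin.succAboveOrderEmb k)) =
        gap a b e + if lo ≤ (k : ℕ) ∧ (k : ℕ) ≤ lo + gap a b e then 1 else 0 := by
  cases a with
  | none =>
    refine ⟨0, by simp [gap], fun k => ?_⟩
    simp only [gap, Option.elim_none, RelEmbedding.coe_trans, Function.comp_apply,
      Fin.succAboveOrderEmb_apply, Fin.succAbove, Fin.lt_def, Fin.val_castSucc]
    split_ifs <;> simp <;> omega
  | some a =>
    have hlt : (e a : ℕ) < e b := e.strictMono (hab a rfl)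
    have hb := (e b).isLt
    refine ⟨e a + 1, by simp only [gap, Option.elim_some]; omega, fun k => ?_⟩
    simp only [gap, Option.elim_some, RelEmbedding.coe_trans, Function.comp_apply,
      Fin.succAboveOrderEmb_apply, Fin.succAbove, Fin.lt_def, Fin.val_castSucc]
    grind [Fin.val_castSucc]

/-- The mean of `harm` of a gap over all order embeddings `Fin m ↪o Fin n`. -/
theorem sum_harm_gap {m n : ℕ} (hmn : m ≤ n) (a : Option (Fin m)) (b : Fin m)
    (hab : ∀ x ∈ a, x < b) :
    ∑ e : Fin m ↪o Fin n, harm (gap a b e) =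
      Fintype.card (Fin m ↪o Fin n) *
        (harm (gap a b (RelEmbedding.refl _ : Fin m ↪o Fin m)) + harm n - harm m) := by
  induction n, hmn using Nat.le_induction with
  | base =>
    have hrefl (e : Fin m ↪o Fin m) : e = RelEmbedding.refl _ := by
      apply DFunLike.coe_injective
      refine (StrictMono.range_inj e.strictMono strictMono_id).1 ?_
      rw [(Finite.injective_iff_surjective.1 e.injective).range_eq, Set.range_id]
    have hconst (e : Fin m ↪o Fin m) :
        harm (gap a b e) = harm (gap a b (RelEmbedding.refl _ : Fin m ↪o Fin m)) := by
      rw [hrefl e]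
    rw [Finset.sum_congr rfl fun e _ => hconst e]
    simp
  | succ n hmn ih =>
    have hpos : (0 : ℝ) < (n : ℝ) + 1 - m := by
      have : (m : ℝ) ≤ n := by exact_mod_cast hmn
      linarith
    refine mul_left_cancel₀ hpos.ne' ?_
    rw [sum_orderEmb_succ hmn, ← mul_assoc, card_orderEmb_succ hmn]
    have hstep (e : Fin m ↪o Fin n) :
        ∑ k : Fin (n + 1), harm (gap a b (e.trans (Fin.succAboveOrderEmb k))) =
          ((n : ℝ) + 1) * harm (gap a b e) + 1 := by
      obtain ⟨lo, hlo, hk⟩ := gap_trans_succAbove a b hab e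
      simp_rw [hk]
      exact sum_harm_add_ite hlo
    simp_rw [hstep]
    rw [Finset.sum_add_distrib, ← Finset.mul_sum, ih, harm_succ]
    simp
    field_simp
    ring

theorem orderEmb_eq_of_range_eq {m n : ℕ} {e e' : Fin m ↪o Fin n}
    (h : Set.range e = Set.range e') : e = e' :=
  DFunLike.coe_injective ((StrictMono.range_inj e.strictMono e'.strictMono).1 h)

theorem orderEmb_compl_exists {m k n : ℕ} (h : m + k = n) (e : Fin m ↪o Fin n) :
    ∃ f : Fin k ↪o Fin n, ∀ i j, e i ≠ f j := by
  have hc : (Finset.univ.map e.toEmbedding)ᶜ.card = k := by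
    rw [Finset.card_compl, Finset.card_map, Finset.card_univ, Fintype.card_fin, Fintype.card_fin]
    omega
  refine ⟨(Finset.univ.map e.toEmbedding)ᶜ.orderEmbOfFin hc, fun i j hij => ?_⟩
  have := Finset.orderEmbOfFin_mem _ hc j
  rw [← hij] at this
  simp at this

theorem range_eq_compl {m k n : ℕ} (h : m + k = n) {e : Fin m ↪o Fin n} {f : Fin k ↪o Fin n}
    (hf : ∀ i j, e i ≠ f j) : Set.range f = (Set.range e)ᶜ := by
  have hsub : Finset.univ.map f.toEmbedding ⊆ (Finset.univ.map e.toEmbedding)ᶜ := by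
    intro x
    simp only [Finset.mem_map, Finset.mem_univ, true_and, Finset.mem_compl, not_exists]
    rintro ⟨j, rfl⟩ i
    exact hf i j
  have heq := Finset.eq_of_subset_of_card_le hsub (by
    rw [Finset.card_compl, Finset.card_map, Finset.card_map, Finset.card_univ, Finset.card_univ,
      Fintype.card_fin, Fintype.card_fin, Fintype.card_fin]
    omega)
  have := congrArg (fun s : Finset (Fin n) => (s : Set (Fin n))) heq
  simpa using this

/-- Ways to interleave `Fin m` and `Fin k` in `Fin n`. -/
noncomputable def shuffles (m k n : ℕ) : Finset ((Fin m ↪o Fin n) × (Fin k ↪o Fin n)) :=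
  Finset.univ.filter fun p => ∀ i j, p.1 i ≠ p.2 j

theorem mem_shuffles {m k n : ℕ} {p : (Fin m ↪o Fin n) × (Fin k ↪o Fin n)} :
    p ∈ shuffles m k n ↔ ∀ i j, p.1 i ≠ p.2 j := by
  simp [shuffles]

theorem sum_shuffles_fst {m k n : ℕ} (h : m + k = n) (F : (Fin m ↪o Fin n) → ℝ) :
    ∑ p ∈ shuffles m k n, F p.1 = ∑ e, F e := by
  refine Finset.sum_bij (fun p _ => p.1) (fun _ _ => Finset.mem_univ _) ?_ ?_ (fun _ _ => rfl)
  · intro p hp q hq hpq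
    rw [mem_shuffles] at hp hq
    refine Prod.ext hpq (orderEmb_eq_of_range_eq ?_)
    rw [range_eq_compl h hp, range_eq_compl h hq, hpq]
  · intro e _
    obtain ⟨f, hf⟩ := orderEmb_compl_exists h e
    exact ⟨(e, f), mem_shuffles.2 hf, rfl⟩

theorem sum_shuffles_snd {m k n : ℕ} (h : m + k = n) (F : (Fin k ↪o Fin n) → ℝ) :
    ∑ p ∈ shuffles m k n, F p.2 = ∑ f, F f := by
  rw [← sum_shuffles_fst (show k + m = n by omega) F]
  refine Finset.sum_equiv (Equiv.prodComm _ _) (fun p => ?_) (fun _ _ => rfl)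
  simp only [mem_shuffles, Equiv.prodComm_apply, Prod.fst_swap, Prod.snd_swap]
  exact ⟨fun h i j => (h j i).symm, fun h i j => (h j i).symm⟩

theorem card_orderEmb_eq_card_shuffles {m k n : ℕ} (h : m + k = n) :
    (Fintype.card (Fin m ↪o Fin n) : ℝ) = (shuffles m k n).card ∧
      (Fintype.card (Fin k ↪o Fin n) : ℝ) = (shuffles m k n).card := by
  constructor
  · simpa using (sum_shuffles_fst h fun _ => 1).symm
  · simpa using (sum_shuffles_snd h fun _ => 1).symm

theorem shuffles_nonempty {m k n : ℕ} (h : m + k = n) : (shuffles m k n).Nonempty := by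
  obtain ⟨f, hf⟩ := orderEmb_compl_exists h (Fin.castLEOrderEmb (show m ≤ n by omega))
  exact ⟨(_, f), mem_shuffles.2 hf⟩

end OrderEmbeddings

/-- The gap determining `dN r σ i` also determines `dN` in any poset containing `r` as a down-closed
part. -/
theorem exists_gap_eq_dN {α : Type} [Fintype α] (r : α → α → Prop)
    {σ : α ≃ Fin (Fintype.card α)} (hσ : σ ∈ linExts α r) (i : α) :
    ∃ a : Option (Fin (Fintype.card α)), (∀ x ∈ a, x < σ i) ∧
      ∀ (γ : Type) [Fintype γ] (t : γ → γ → Prop) (ι : α → γ) (ρ : γ ≃ Fin (Fintype.card γ))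
        (e : Fin (Fintype.card α) ↪o Fin (Fintype.card γ)),
        Function.Injective ι → (∀ x, t x (ι i) ↔ ∃ j, x = ι j ∧ r j i) →
        (∀ j, ρ (ι j) = e (σ j)) → dN t ρ (ι i) - 1 = gap a (σ i) e := by
  simp only [linExts, Finset.mem_filter, Finset.mem_univ, true_and] at hσ
  by_cases hmin : ∀ j, r j i → j = i
  · refine ⟨none, by simp, fun γ _ t ι ρ e hι ht hρ => ?_⟩
    have hmin' : ∀ x, t x (ι i) → x = ι i := by
      intro x hx
      obtain ⟨j, rfl, hj⟩ := (ht x).1 hx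
      rw [hmin j hj]
    rw [dN, if_pos hmin', hρ]
    simp [gap]
  · push Not at hmin
    have hne : ({j | r j i ∧ j ≠ i} : Finset α).Nonempty := by
      obtain ⟨j, hj⟩ := hmin
      exact ⟨j, by simpa using hj⟩
    obtain ⟨j, hj, hmax⟩ := Finset.exists_max_image _ σ hne
    simp only [Finset.mem_filter, Finset.mem_univ, true_and] at hj hmax
    refine ⟨some (σ j), ?_, fun γ _ t ι ρ e hι ht hρ => ?_⟩
    · rintro x hx
      obtain rfl : σ j = x := by simpa using hx
      exact lt_of_le_of_ne (hσ j i hj.1) fun h => hj.2 (σ.injective h)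
    · have hmin' : ¬ ∀ x, t x (ι i) → x = ι i := fun h =>
        hj.2 (hι (h (ι j) ((ht _).2 ⟨j, rfl, hj.1⟩)))
      have hleast : IsLeast {m : ℕ | ∃ x : γ, x ≠ ι i ∧ t x (ι i) ∧ m = (ρ (ι i) : ℕ) - (ρ x : ℕ)}
          ((e (σ i) : ℕ) - e (σ j)) := by
        constructor
        · exact ⟨ι j, fun h => hj.2 (hι h), (ht _).2 ⟨j, rfl, hj.1⟩, by rw [hρ, hρ]⟩
        · rintro _ ⟨x, hx, hxi, rfl⟩
          obtain ⟨l, rfl, hl⟩ := (ht x).1 hxi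
          rw [hρ, hρ]
          have : e (σ l) ≤ e (σ j) := e.monotone (hmax l ⟨hl, fun h => hx (by rw [h])⟩)
          exact Nat.sub_le_sub_left this _
      rw [dN, if_neg hmin', hleast.csInf_eq]
      simp [gap]

/-- Summing over embeddings the contribution of one linear extension to `QLB`. -/
theorem sum_sum_harm_gap {α : Type} [Fintype α] (r : α → α → Prop) {n : ℕ}
    (hn : Fintype.card α ≤ n) {σ : α ≃ Fin (Fintype.card α)}
    {a : α → Option (Fin (Fintype.card α))} (ha : ∀ i, ∀ x ∈ a i, x < σ i)
    (hd : ∀ i, dN r σ i - 1 =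
      gap (a i) (σ i) (RelEmbedding.refl _ : Fin (Fintype.card α) ↪o Fin (Fintype.card α))) :
    ∑ e : Fin (Fintype.card α) ↪o Fin n, ∑ i, harm (gap (a i) (σ i) e) =
      Fintype.card (Fin (Fintype.card α) ↪o Fin n) *
        (∑ i, harm (dN r σ i - 1) + Fintype.card α * (harm n - harm (Fintype.card α))) := by
  rw [Finset.sum_comm, Finset.sum_congr rfl fun i _ => sum_harm_gap hn (a i) (σ i) (ha i),
    ← Finset.mul_sum]
  simp_rw [hd, add_sub_assoc]
  rw [Finset.sum_add_distrib, Finset.sum_const, Finset.card_univ, nsmul_eq_mul]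

/-- An injection into `Fin n` is an order embedding composed with a bijection. -/
theorem exists_orderEmb_comp_equiv {α : Type} [Fintype α] {n : ℕ} {g : α → Fin n}
    (hg : Function.Injective g) :
    ∃ (σ : α ≃ Fin (Fintype.card α)) (e : Fin (Fintype.card α) ↪o Fin n),
      ∀ i, e (σ i) = g i := by
  let s := Finset.univ.map ⟨g, hg⟩
  have hs : s.card = Fintype.card α := by simp [s]
  have hmem (i : α) : g i ∈ s := by simp [s]
  have hinj : Function.Injective fun i => (s.orderIsoOfFin hs).symm ⟨g i, hmem i⟩ := by
    intro i j hij
    simpa using hg (congrArg Subtype.val ((s.orderIsoOfFin hs).symm.injective hij))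
  refine ⟨Equiv.ofBijective _ ((Fintype.bijective_iff_injective_and_card _).2 ⟨hinj, by simp⟩),
    s.orderEmbOfFin hs, fun i => ?_⟩
  simp [← Finset.coe_orderIsoOfFin_apply]

theorem orderEmb_comp_equiv_inj {α : Type} [Fintype α] {n : ℕ}
    {σ σ' : α ≃ Fin (Fintype.card α)} {e e' : Fin (Fintype.card α) ↪o Fin n}
    (h : ∀ i, e (σ i) = e' (σ' i)) : σ = σ' ∧ e = e' := by
  have hcomp : e ∘ σ = e' ∘ σ' := funext h
  have he : e = e' := by
    apply orderEmb_eq_of_range_eq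
    rw [← σ.surjective.range_comp e, hcomp, σ'.surjective.range_comp e']
  subst he
  exact ⟨Equiv.ext fun i => e.injective (h i), rfl⟩

section Parallel

variable {α β : Type} [Fintype α] [Fintype β]

/-- The labelling of `α ⊕ β` interleaving two labellings along a shuffle. -/
noncomputable def interleave (σ : α ≃ Fin (Fintype.card α)) (τ : β ≃ Fin (Fintype.card β))
    (p : (Fin (Fintype.card α) ↪o Fin (Fintype.card (α ⊕ β))) ×
      (Fin (Fintype.card β) ↪o Fin (Fintype.card (α ⊕ β))))
    (hp : p ∈ shuffles _ _ _) : α ⊕ β ≃ Fin (Fintype.card (α ⊕ β)) :=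
  Equiv.ofBijective (Sum.elim (fun i => p.1 (σ i)) fun j => p.2 (τ j)) <| by
    rw [Fintype.bijective_iff_injective_and_card]
    refine ⟨Function.Injective.sumElim (p.1.injective.comp σ.injective)
      (p.2.injective.comp τ.injective) fun i j => mem_shuffles.1 hp _ _, by simp⟩

variable (r : α → α → Prop) (s : β → β → Prop)

/-- A quantity that depends on a labelling of `α ⊕ β` only through its decomposition can be summed
over linear extensions of the parallel composition factor by factor. -/
theorem sum_linExts_parallelComp (F : (α ⊕ β ≃ Fin (Fintype.card (α ⊕ β))) → ℝ)
    (G : (α ≃ Fin (Fintype.card α)) → (β ≃ Fin (Fintype.card β)) →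
      ((Fin (Fintype.card α) ↪o Fin (Fintype.card (α ⊕ β))) ×
        (Fin (Fintype.card β) ↪o Fin (Fintype.card (α ⊕ β)))) → ℝ)
    (hFG : ∀ σ ∈ linExts α r, ∀ τ ∈ linExts β s, ∀ p, ∀ ρ,
      (∀ i, ρ (Sum.inl i) = p.1 (σ i)) → (∀ j, ρ (Sum.inr j) = p.2 (τ j)) → F ρ = G σ τ p) :
    ∑ ρ ∈ linExts (α ⊕ β) (parallelComp r s), F ρ =
      ∑ σ ∈ linExts α r, ∑ τ ∈ linExts β s, ∑ p ∈ shuffles _ _ _, G σ τ p := by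
  simp_rw [← Finset.sum_product']
  symm
  refine Finset.sum_bij (fun x hx => interleave x.1 x.2.1 x.2.2 ?_) ?_ ?_ ?_ ?_
  · simp only [Finset.mem_product] at hx
    exact hx.2.2
  · rintro ⟨σ, τ, p⟩ hx
    simp only [Finset.mem_product, linExts, Finset.mem_filter, Finset.mem_univ, true_and] at hx ⊢
    rintro (i | i) (j | j) hij
    · exact p.1.monotone (hx.1 i j hij)
    · exact hij.elim
    · exact hij.elim
    · exact p.2.monotone (hx.2.1 i j hij)
  · rintro ⟨σ, τ, e, f⟩ hx ⟨σ', τ', e', f'⟩ hx' h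
    obtain ⟨rfl, rfl⟩ := orderEmb_comp_equiv_inj fun i => DFunLike.congr_fun h (Sum.inl i)
    obtain ⟨rfl, rfl⟩ := orderEmb_comp_equiv_inj fun j => DFunLike.congr_fun h (Sum.inr j)
    rfl
  · intro ρ hρ
    obtain ⟨σ, e, he⟩ := exists_orderEmb_comp_equiv (ρ.injective.comp (Sum.inl_injective (β := β)))
    obtain ⟨τ, f, hf⟩ := exists_orderEmb_comp_equiv (ρ.injective.comp (Sum.inr_injective (α := α)))
    simp only [Function.comp_apply] at he hf
    simp only [linExts, Finset.mem_filter, Finset.mem_univ, true_and] at hρ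
    refine ⟨(σ, τ, e, f), ?_, ?_⟩
    · simp only [Finset.mem_product, linExts, Finset.mem_filter, Finset.mem_univ, true_and,
        mem_shuffles]
      refine ⟨fun i j hij => ?_, fun i j hij => ?_, fun i j hij => ?_⟩
      · rw [← e.le_iff_le, he, he]
        exact hρ _ _ hij
      · rw [← f.le_iff_le, hf, hf]
        exact hρ _ _ hij
      · have h₁ := he (σ.symm i)
        have h₂ := hf (τ.symm j)
        rw [Equiv.apply_symm_apply] at h₁ h₂
        rw [h₁, h₂] at hij
        simpa using ρ.injective hij
    · ext x : 1
      rcases x with i | j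
      · exact he i
      · exact hf j
  · rintro ⟨σ, τ, p⟩ hx
    simp only [Finset.mem_product] at hx
    exact (hFG σ hx.1 τ hx.2.1 p _ (fun _ => rfl) fun _ => rfl).symm

end Parallel

/-- `QLB(P + Q) = QLB(P) + QLB(Q) + n H_n − n1 H_{n1} − n2 H_{n2}`. -/
theorem stmt_8 (α β : Type) [Fintype α] [Fintype β]
    (r : α → α → Prop) (s : β → β → Prop)
    [IsPartialOrder α r] [IsPartialOrder β s] :
    QLB (α ⊕ β) (parallelComp r s) =
      QLB α r + QLB β s
        + ((Fintype.card α + Fintype.card β : ℕ) : ℝ) * harm (Fintype.card α + Fintype.card β)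
        - (Fintype.card α : ℝ) * harm (Fintype.card α)
        - (Fintype.card β : ℝ) * harm (Fintype.card β) := by
  have hN : Fintype.card α + Fintype.card β = Fintype.card (α ⊕ β) := Fintype.card_sum.symm
  obtain ⟨hE₁, hE₂⟩ := card_orderEmb_eq_card_shuffles hN
  have hE : ((shuffles (Fintype.card α) (Fintype.card β) (Fintype.card (α ⊕ β))).card : ℝ) ≠ 0 := by
    exact_mod_cast (shuffles_nonempty hN).card_ne_zero
  have hL : ((linExts α r).card : ℝ) ≠ 0 := by
    exact_mod_cast (linExts_nonempty α r).card_ne_zero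
  have hT : ((linExts β s).card : ℝ) ≠ 0 := by
    exact_mod_cast (linExts_nonempty β s).card_ne_zero
  choose! a ha hda using fun σ (hσ : σ ∈ linExts α r) => exists_gap_eq_dN r hσ
  choose! b hb hdb using fun τ (hτ : τ ∈ linExts β s) => exists_gap_eq_dN s hτ
  have hcard : ((linExts (α ⊕ β) (parallelComp r s)).card : ℝ) =
      (linExts α r).card * ((linExts β s).card *
        (shuffles (Fintype.card α) (Fintype.card β) (Fintype.card (α ⊕ β))).card) := by
    have := sum_linExts_parallelComp r s (fun _ => 1) (fun _ _ _ => 1)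
      (fun _ _ _ _ _ _ _ _ => rfl)
    simpa using this
  have hsum := sum_linExts_parallelComp r s
    (fun ρ => ∑ x, harm (dN (parallelComp r s) ρ x - 1))
    (fun σ τ p => ∑ i, harm (gap (a σ i) (σ i) p.1) + ∑ j, harm (gap (b τ j) (τ j) p.2)) (by
      intro σ hσ τ hτ p ρ hi hj
      rw [Fintype.sum_sum_type]
      congr 1
      · refine Finset.sum_congr rfl fun i _ => ?_
        rw [hda σ hσ i (α ⊕ β) (parallelComp r s) Sum.inl ρ p.1 Sum.inl_injective ?_ hi]
        rintro (x | x) <;> simp [parallelComp]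
      · refine Finset.sum_congr rfl fun j _ => ?_
        rw [hdb τ hτ j (α ⊕ β) (parallelComp r s) Sum.inr ρ p.2 Sum.inr_injective ?_ hj]
        rintro (x | x) <;> simp [parallelComp])
  have hα (σ) (hσ : σ ∈ linExts α r) :
      ∑ p ∈ shuffles (Fintype.card α) (Fintype.card β) (Fintype.card (α ⊕ β)),
        ∑ i, harm (gap (a σ i) (σ i) p.1) =
      (shuffles (Fintype.card α) (Fintype.card β) (Fintype.card (α ⊕ β))).card *
        (∑ i, harm (dN r σ i - 1) +
          Fintype.card α * (harm (Fintype.card (α ⊕ β)) - harm (Fintype.card α))) := by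
    rw [sum_shuffles_fst hN fun e => ∑ i, harm (gap (a σ i) (σ i) e), ← hE₁]
    exact sum_sum_harm_gap r (by omega) (ha σ hσ) fun i =>
      hda σ hσ i α r id σ (RelEmbedding.refl _) Function.injective_id (by simp) fun _ => rfl
  have hβ (τ) (hτ : τ ∈ linExts β s) :
      ∑ p ∈ shuffles (Fintype.card α) (Fintype.card β) (Fintype.card (α ⊕ β)),
        ∑ j, harm (gap (b τ j) (τ j) p.2) =
      (shuffles (Fintype.card α) (Fintype.card β) (Fintype.card (α ⊕ β))).card *
        (∑ j, harm (dN s τ j - 1) +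
          Fintype.card β * (harm (Fintype.card (α ⊕ β)) - harm (Fintype.card β))) := by
    rw [sum_shuffles_snd hN fun e => ∑ i, harm (gap (b τ i) (τ i) e), ← hE₂]
    exact sum_sum_harm_gap s (by omega) (hb τ hτ) fun i =>
      hdb τ hτ i β s id τ (RelEmbedding.refl _) Function.injective_id (by simp) fun _ => rfl
  have htotal : ∑ σ ∈ linExts α r, ∑ τ ∈ linExts β s,
      ∑ p ∈ shuffles (Fintype.card α) (Fintype.card β) (Fintype.card (α ⊕ β)),
        (∑ i, harm (gap (a σ i) (σ i) p.1) + ∑ j, harm (gap (b τ j) (τ j) p.2)) =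
      (shuffles (Fintype.card α) (Fintype.card β) (Fintype.card (α ⊕ β))).card *
        ((linExts β s).card * (∑ σ ∈ linExts α r, ∑ i, harm (dN r σ i - 1)) +
          (linExts α r).card * (∑ τ ∈ linExts β s, ∑ j, harm (dN s τ j - 1)) +
          (linExts α r).card * (linExts β s).card *
            (Fintype.card α * (harm (Fintype.card (α ⊕ β)) - harm (Fintype.card α)) +
              Fintype.card β * (harm (Fintype.card (α ⊕ β)) - harm (Fintype.card β)))) := by
    rw [Finset.sum_congr rfl fun σ hσ => Finset.sum_congr rfl fun τ hτ => by
      rw [Finset.sum_add_distrib, hα σ hσ, hβ τ hτ, ← mul_add]]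
    simp only [← Finset.mul_sum, Finset.sum_add_distrib, Finset.sum_const, nsmul_eq_mul]
    ring
  rw [Nat.cast_add, hN, QLB, QLB, QLB, hsum, htotal, hcard]
  field_simp
  ring
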